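/- Let φ : GL_n(F) → ℂ be a function for which there exists an integer n₀ ≥ 1 with φ(k₁·g·k₂) = φ(g) for all g ∈ GL_n(F) and all k₁, k₂ ∈ K_{n₀}. Then for every x ∈ Fˣ the limit k(x) := lim_{ℓ→∞} ∫_{det g = x} (Φ_GJ * c_ℓ^∨)(g)·φ(g) d_xg exists (the sequence of integrals is eventually constant in ℓ, uniformly for x in any open compact subset of Fˣ), and the resulting function k : Fˣ → ℂ is smooth, i.e., locally constant on Fˣ. -/

import Mathlib

open MeasureTheory Matrix

/-- `M_n(𝔭^k)`: matrices over `F` with all entries in `𝔭^k` (norm at most `‖ϖ‖^k`). -/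
def MnP (n : ℕ) {F : Type*} [NontriviallyNormedField F] (ϖ : F) (k : ℤ) :
    Set (Matrix (Fin n) (Fin n) F) :=
  {g | ∀ i j, ‖g i j‖ ≤ ‖ϖ‖ ^ k}

/-- The principal congruence subgroup `K_ℓ = I_n + M_n(𝔭^ℓ)`, as a set of matrices. -/
def Kcong (n : ℕ) {F : Type*} [NontriviallyNormedField F] (ϖ : F) (ℓ : ℤ) :
    Set (Matrix (Fin n) (Fin n) F) :=
  {g | ∀ i j, ‖g i j - (1 : Matrix (Fin n) (Fin n) F) i j‖ ≤ ‖ϖ‖ ^ ℓ}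

/-- The Haar measure `dg = d⁺g / |det g|^n` on `GL_n(F)`, obtained from the additive Haar
measure `μp` on `M_n(F)` by the density `|det g|_F^{-n}`. -/
noncomputable def muGL (n : ℕ) {F : Type*} [NontriviallyNormedField F]
    [MeasurableSpace (Matrix (Fin n) (Fin n) F)]
    (μp : Measure (Matrix (Fin n) (Fin n) F)) : Measure (Matrix (Fin n) (Fin n) F) :=
  μp.withDensity fun g => ENNReal.ofReal ((‖g.det‖ ^ n)⁻¹)

/-- `c_ℓ = vol(K_ℓ)⁻¹ · 1_{K_ℓ}`, the characteristic function of the principal congruence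
subgroup `K_ℓ` normalized by its volume for the Haar measure of `GL_n(F)`. -/
noncomputable def cFun (n : ℕ) {F : Type*} [NontriviallyNormedField F]
    [MeasurableSpace (Matrix (Fin n) (Fin n) F)]
    (μp : Measure (Matrix (Fin n) (Fin n) F)) (ϖ : F) (ℓ : ℤ) :
    Matrix (Fin n) (Fin n) F → ℂ :=
  (Kcong n ϖ ℓ).indicator fun _ => (((muGL n μp (Kcong n ϖ ℓ)).toReal : ℂ))⁻¹

/-- The Godement–Jacquet kernel `Φ_GJ(g) = ψ(tr g)·|det g|_F^{n/2}`. -/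
noncomputable def PhiGJ (n : ℕ) {F : Type*} [NontriviallyNormedField F] (ψ : F → ℂ) :
    Matrix (Fin n) (Fin n) F → ℂ :=
  fun g => ψ g.trace * ((‖g.det‖ ^ ((n : ℝ) / 2) : ℝ) : ℂ)

/-- The convolution `(Φ_GJ * ξ^∨)(g) = ∫_{GL_n(F)} Φ_GJ(h)·ξ(g⁻¹h) dh`, the integral being
taken with respect to the Haar measure of `GL_n(F)`. -/
noncomputable def convGJ (n : ℕ) {F : Type*} [NontriviallyNormedField F]
    [MeasurableSpace (Matrix (Fin n) (Fin n) F)]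
    (μp : Measure (Matrix (Fin n) (Fin n) F)) (ψ : F → ℂ)
    (ξ : Matrix (Fin n) (Fin n) F → ℂ) (g : Matrix (Fin n) (Fin n) F) : ℂ :=
  ∫ h, PhiGJ n ψ h * ξ (g⁻¹ * h) ∂(muGL n μp)

/-- `t₁(x) = diag(x, 1, …, 1)`, a section of the determinant map. -/
noncomputable def t1 (n : ℕ) {F : Type*} [NontriviallyNormedField F] (x : F) :
    Matrix (Fin n) (Fin n) F :=
  Matrix.diagonal fun i => if (i : ℕ) = 0 then x else 1

section EntryNorm

variable {n : ℕ} {F : Type*} [NontriviallyNormedField F]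

/-- The maximum of the norms of the entries of a matrix. -/
noncomputable def entryNorm (g : Matrix (Fin n) (Fin n) F) : ℝ :=
  ‖(fun i j => g i j : Fin n → Fin n → F)‖

lemma entryNorm_nonneg (g : Matrix (Fin n) (Fin n) F) : 0 ≤ entryNorm g := norm_nonneg _

lemma entryNorm_le_iff {g : Matrix (Fin n) (Fin n) F} {r : ℝ} (hr : 0 ≤ r) :
    entryNorm g ≤ r ↔ ∀ i j, ‖g i j‖ ≤ r := by
  simp only [entryNorm, pi_norm_le_iff_of_nonneg hr]

lemma entryNorm_lt_iff {g : Matrix (Fin n) (Fin n) F} {r : ℝ} (hr : 0 < r) :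
    entryNorm g < r ↔ ∀ i j, ‖g i j‖ < r := by
  simp only [entryNorm, pi_norm_lt_iff hr]

lemma norm_entry_le_entryNorm (g : Matrix (Fin n) (Fin n) F) (i j : Fin n) :
    ‖g i j‖ ≤ entryNorm g :=
  (entryNorm_le_iff (entryNorm_nonneg g)).1 le_rfl i j

lemma continuous_entryNorm : Continuous (entryNorm : Matrix (Fin n) (Fin n) F → ℝ) :=
  continuous_norm (E := Fin n → Fin n → F)

lemma entryNorm_eq_zero_iff {g : Matrix (Fin n) (Fin n) F} : entryNorm g = 0 ↔ g = 0 :=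
  norm_eq_zero (E := Fin n → Fin n → F)

lemma isCompact_entryNorm_le [ProperSpace F] (r : ℝ) :
    IsCompact {g : Matrix (Fin n) (Fin n) F | entryNorm g ≤ r} := by
  have h := isCompact_closedBall (0 : Fin n → Fin n → F) r
  have hs : Metric.closedBall (0 : Fin n → Fin n → F) r = {g | ‖g‖ ≤ r} := by
    ext
    simp
  rw [hs] at h
  exact h

lemma entryNorm_one_le : entryNorm (1 : Matrix (Fin n) (Fin n) F) ≤ 1 := by
  rw [entryNorm_le_iff zero_le_one]
  intro i j
  by_cases h : i = j <;> simp [Matrix.one_apply, h]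

lemma entryNorm_smul (t : F) (g : Matrix (Fin n) (Fin n) F) :
    entryNorm (t • g) = ‖t‖ * entryNorm g :=
  norm_smul (β := Fin n → Fin n → F) t _

lemma secondCountableTopology_matrix [ProperSpace F] :
    SecondCountableTopology (Matrix (Fin n) (Fin n) F) :=
  inferInstanceAs (SecondCountableTopology (Fin n → Fin n → F))

lemma locallyCompactSpace_matrix [ProperSpace F] :
    LocallyCompactSpace (Matrix (Fin n) (Fin n) F) :=
  inferInstanceAs (LocallyCompactSpace (Fin n → Fin n → F))

variable [IsUltrametricDist F]

lemma entryNorm_add_le_max (g h : Matrix (Fin n) (Fin n) F) :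
    entryNorm (g + h) ≤ max (entryNorm g) (entryNorm h) :=
  IsUltrametricDist.norm_add_le_max (S := Fin n → Fin n → F) _ _

lemma entryNorm_add_eq_of_lt {g h : Matrix (Fin n) (Fin n) F} (hgh : entryNorm h < entryNorm g) :
    entryNorm (g + h) = entryNorm g := by
  have := IsUltrametricDist.norm_add_eq_max_of_norm_ne_norm (S := Fin n → Fin n → F)
    (x := fun i j => g i j) (y := fun i j => h i j) hgh.ne'
  exact this.trans (max_eq_left hgh.le)

lemma norm_add_eq_of_lt {x y : F} (h : ‖y‖ < ‖x‖) : ‖x + y‖ = ‖x‖ := by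
  rw [IsUltrametricDist.norm_add_eq_max_of_norm_ne_norm h.ne', max_eq_left h.le]

lemma entryNorm_mul_le (g h : Matrix (Fin n) (Fin n) F) :
    entryNorm (g * h) ≤ entryNorm g * entryNorm h := by
  have h0 := mul_nonneg (entryNorm_nonneg g) (entryNorm_nonneg h)
  rw [entryNorm_le_iff h0]
  intro i j
  rw [Matrix.mul_apply]
  refine IsUltrametricDist.norm_sum_le_of_forall_le_of_nonneg h0 fun k _ => ?_
  rw [norm_mul]
  exact mul_le_mul (norm_entry_le_entryNorm _ _ _) (norm_entry_le_entryNorm _ _ _)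
    (norm_nonneg _) (entryNorm_nonneg _)

lemma norm_trace_le_entryNorm (g : Matrix (Fin n) (Fin n) F) : ‖g.trace‖ ≤ entryNorm g :=
  IsUltrametricDist.norm_sum_le_of_forall_le_of_nonneg (entryNorm_nonneg g) fun i _ =>
    norm_entry_le_entryNorm g i i

/-- Left multiplication by a matrix that is congruent to `1` preserves the entry norm. -/
lemma entryNorm_mul_left {k : Matrix (Fin n) (Fin n) F} (hk : entryNorm (k - 1) < 1)
    (g : Matrix (Fin n) (Fin n) F) : entryNorm (k * g) = entryNorm g := by
  have hkg : k * g = g + (k - 1) * g := by rw [sub_mul, one_mul]; abel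
  rcases eq_or_ne g 0 with rfl | hg
  · simp
  · have hpos : 0 < entryNorm g :=
      (entryNorm_nonneg g).lt_of_ne fun h => hg (entryNorm_eq_zero_iff.1 h.symm)
    rw [hkg]
    exact entryNorm_add_eq_of_lt
      ((entryNorm_mul_le _ _).trans_lt ((mul_lt_iff_lt_one_left hpos).2 hk))

/-- A matrix that is congruent to `1` has determinant of norm one. -/
lemma norm_det_eq_one {k : Matrix (Fin n) (Fin n) F} (hk : entryNorm (k - 1) < 1) :
    ‖k.det‖ = 1 := by
  have hent : ∀ i j, ‖(k - 1) i j‖ < 1 := (entryNorm_lt_iff one_pos).1 hk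
  have hdiag : ∀ i, ‖k i i‖ = 1 := fun i => by
    have h := norm_add_eq_of_lt (x := (1 : F)) (y := (k - 1) i i) (by simpa using hent i i)
    simpa using h
  have hoff : ∀ i j, i ≠ j → ‖k i j‖ < 1 := fun i j hij => by
    simpa [Matrix.one_apply, hij] using hent i j
  have hle : ∀ i j, ‖k i j‖ ≤ 1 := fun i j => by
    by_cases hij : i = j
    · subst hij; exact (hdiag i).le
    · exact (hoff i j hij).le
  rw [Matrix.det_apply, ← Finset.add_sum_erase _ _ (Finset.mem_univ (1 : Equiv.Perm (Fin n)))]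
  have h1 : ‖Equiv.Perm.sign (1 : Equiv.Perm (Fin n)) •
      ∏ i, k ((1 : Equiv.Perm (Fin n)) i) i‖ = 1 := by
    simp [norm_prod, hdiag]
  rw [norm_add_eq_of_lt, h1]
  rw [h1]
  have hlt : ∀ σ ∈ Finset.univ.erase (1 : Equiv.Perm (Fin n)),
      ‖Equiv.Perm.sign σ • ∏ i, k (σ i) i‖ < 1 := by
    intro σ hσ
    have hσ1 : σ ≠ 1 := (Finset.mem_erase.1 hσ).1
    obtain ⟨i, hi⟩ : ∃ i, σ i ≠ i := by
      by_contra! h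
      exact hσ1 (Equiv.ext h)
    have hs : ‖Equiv.Perm.sign σ • ∏ i, k (σ i) i‖ = ∏ i, ‖k (σ i) i‖ := by
      rcases Int.units_eq_one_or (Equiv.Perm.sign σ) with h | h <;> simp [h, norm_prod]
    rw [hs, ← Finset.mul_prod_erase _ _ (Finset.mem_univ i)]
    exact mul_lt_one_of_nonneg_of_lt_one_left (norm_nonneg _) (hoff _ _ hi)
      (Finset.prod_le_one (fun _ _ => norm_nonneg _) fun _ _ => hle _ _)
  obtain ⟨σ, hσ, hmax⟩ := IsUltrametricDist.exists_norm_finsetSum_le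
    (Finset.univ.erase (1 : Equiv.Perm (Fin n))) fun σ => Equiv.Perm.sign σ • ∏ i, k (σ i) i
  rcases Finset.eq_empty_or_nonempty (Finset.univ.erase (1 : Equiv.Perm (Fin n))) with h | h
  · rw [h]; simp
  · exact hmax.trans_lt (hlt σ (hσ h))

/-- If every rank one trace form `g ↦ v ⬝ᵥ g *ᵥ u` with `v ⬝ᵥ u = 0` built from signed sums of at
most two basis vectors is smaller than the entry norm, then `g` is nearly scalar, so its
determinant is as large as possible. -/
lemma norm_det_eq_entryNorm_pow [NeZero n] {g : Matrix (Fin n) (Fin n) F} (hg : g ≠ 0)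
    (hoff : ∀ a b, a ≠ b → ‖g a b‖ < entryNorm g)
    (hdiag : ∀ a b, a ≠ b → ‖g a a + g a b - g b a - g b b‖ < entryNorm g) :
    ‖g.det‖ = entryNorm g ^ n := by
  have hpos : 0 < entryNorm g :=
    (entryNorm_nonneg g).lt_of_ne fun h => hg (entryNorm_eq_zero_iff.1 h.symm)
  set c : F := g 0 0 with hc
  have hdd : ∀ a, ‖g a a - c‖ < entryNorm g := by
    intro a
    by_cases ha : a = 0
    · subst ha; simpa [hc] using hpos
    · have h1 := hdiag a 0 ha
      have h2 := hoff a 0 ha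
      have h3 := hoff 0 a (Ne.symm ha)
      have : g a a - c = (g a a + g a 0 - g 0 a - g 0 0) + (g 0 a + -g a 0) := by rw [hc]; ring
      rw [this]
      refine (IsUltrametricDist.norm_add_le_max _ _).trans_lt (max_lt h1 ?_)
      refine (IsUltrametricDist.norm_add_le_max _ _).trans_lt (max_lt h3 ?_)
      rwa [norm_neg]
  have hsub : entryNorm (g - c • 1) < entryNorm g := by
    rw [entryNorm_lt_iff hpos]
    intro a b
    by_cases hab : a = b
    · subst hab; simpa using hdd a
    · simpa [Matrix.one_apply, hab] using hoff a b hab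
  have hcn : ‖c‖ = entryNorm g := by
    refine le_antisymm (norm_entry_le_entryNorm _ _ _) ?_
    by_contra! hlt
    refine lt_irrefl (entryNorm g) ?_
    have : g = c • 1 + (g - c • 1) := by abel
    calc entryNorm g = entryNorm (c • 1 + (g - c • 1)) := by rw [← this]
      _ ≤ _ := entryNorm_add_le_max _ _
      _ < entryNorm g := max_lt (by
        rw [entryNorm_smul]
        exact (mul_le_of_le_one_right (norm_nonneg _) entryNorm_one_le).trans_lt hlt) hsub
  have hc0 : c ≠ 0 := by rw [← norm_pos_iff, hcn]; exact hpos
  have hk : entryNorm (c⁻¹ • g - 1) < 1 := by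
    have : c⁻¹ • g - 1 = c⁻¹ • (g - c • 1) := by
      rw [smul_sub, smul_smul, inv_mul_cancel₀ hc0, one_smul]
    rw [this, entryNorm_smul, norm_inv, hcn, inv_mul_lt_one₀ hpos]
    exact hsub
  have hgc : g = c • (c⁻¹ • g) := by rw [smul_smul, mul_inv_cancel₀ hc0, one_smul]
  rw [hgc, Matrix.det_smul, norm_mul, norm_det_eq_one hk, mul_one, ← hgc, norm_pow, hcn]
  simp

end EntryNorm

section AdditiveCharacter

variable {F : Type*} [NontriviallyNormedField F]

lemma exists_char_mul_ne_one {ϖ : F} (hϖ0 : 0 < ‖ϖ‖) (hϖ1 : ‖ϖ‖ < 1)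
    (hdisc : ∀ x : F, x ≠ 0 → ∃ k : ℤ, ‖x‖ = ‖ϖ‖ ^ k)
    {ψ : F → ℂ} (hψnontriv : ∃ x : F, ‖x‖ ≤ ‖ϖ‖⁻¹ ∧ ψ x ≠ 1)
    {y : F} {m : ℤ} (hy : ‖ϖ‖ ^ (-m) < ‖y‖) : ∃ t : F, ‖t‖ ≤ ‖ϖ‖ ^ m ∧ ψ (t * y) ≠ 1 := by
  obtain ⟨z, hz, hψz⟩ := hψnontriv
  have hy0 : y ≠ 0 := norm_pos_iff.1 ((zpow_pos hϖ0 _).trans hy)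
  obtain ⟨k, hk⟩ := hdisc y hy0
  rw [hk, zpow_lt_zpow_iff_right_of_lt_one₀ hϖ0 hϖ1] at hy
  refine ⟨z / y, ?_, by rwa [div_mul_cancel₀ _ hy0]⟩
  rw [norm_div, hk]
  calc ‖z‖ / ‖ϖ‖ ^ k ≤ ‖ϖ‖⁻¹ / ‖ϖ‖ ^ k := by gcongr
    _ = ‖ϖ‖ ^ (-1 - k) := by rw [zpow_sub₀ hϖ0.ne', _root_.zpow_neg_one]
    _ ≤ ‖ϖ‖ ^ m := zpow_le_zpow_right_of_le_one₀ hϖ0 hϖ1.le (by omega)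

end AdditiveCharacter

section HaarScaling

variable {n : ℕ} {F : Type*} [NontriviallyNormedField F]

/-- Left multiplication by an invertible matrix, as an additive automorphism. -/
noncomputable def mulLeftAddEquiv (A : Matrix (Fin n) (Fin n) F) (hA : A.det ≠ 0) :
    Matrix (Fin n) (Fin n) F ≃+ Matrix (Fin n) (Fin n) F where
  toFun X := A * X
  invFun X := A⁻¹ * X
  left_inv X := Matrix.nonsing_inv_mul_cancel_left A X hA.isUnit
  right_inv X := Matrix.mul_nonsing_inv_cancel_left A X hA.isUnit
  map_add' X Y := mul_add A X Y

lemma continuous_mulLeft_matrix (A : Matrix (Fin n) (Fin n) F) :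
    Continuous fun X : Matrix (Fin n) (Fin n) F => A * X :=
  continuous_const.matrix_mul continuous_id

variable [MeasurableSpace (Matrix (Fin n) (Fin n) F)] [BorelSpace (Matrix (Fin n) (Fin n) F)]

lemma measurableEmbedding_matrix_mulLeft {A : Matrix (Fin n) (Fin n) F} (hA : A.det ≠ 0) :
    MeasurableEmbedding fun X : Matrix (Fin n) (Fin n) F => A * X :=
  let e : Matrix (Fin n) (Fin n) F ≃ₜ Matrix (Fin n) (Fin n) F :=
    { (mulLeftAddEquiv A hA).toEquiv with
      continuous_toFun := continuous_mulLeft_matrix A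
      continuous_invFun := continuous_mulLeft_matrix A⁻¹ }
  e.measurableEmbedding

lemma measurableSet_entryNorm_le (r : ℝ) :
    MeasurableSet {g : Matrix (Fin n) (Fin n) F | entryNorm g ≤ r} :=
  (isClosed_le continuous_entryNorm continuous_const).measurableSet

variable (μp : Measure (Matrix (Fin n) (Fin n) F))

/-- The factor by which left multiplication by `g` scales an additive Haar measure. -/
noncomputable def haarFactor (g : Matrix (Fin n) (Fin n) F) : ℝ :=
  (μp.map (fun X => g⁻¹ * X)).real {X | entryNorm X ≤ 1} / μp.real {X | entryNorm X ≤ 1}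

lemma haarFactor_eq (g : Matrix (Fin n) (Fin n) F) :
    haarFactor μp g = μp.real {X | entryNorm (g⁻¹ * X) ≤ 1} / μp.real {X | entryNorm X ≤ 1} := by
  rw [haarFactor, map_measureReal_apply (continuous_mulLeft_matrix _).measurable
    (measurableSet_entryNorm_le 1)]
  rfl

variable [μp.IsAddHaarMeasure] [ProperSpace F]

omit [BorelSpace (Matrix (Fin n) (Fin n) F)] [ProperSpace F] in
lemma measure_entryNorm_le_pos {r : ℝ} (hr : 0 < r) :
    0 < μp {X : Matrix (Fin n) (Fin n) F | entryNorm X ≤ r} := by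
  have ho : IsOpen {X : Matrix (Fin n) (Fin n) F | entryNorm X < r} :=
    isOpen_lt continuous_entryNorm continuous_const
  refine (ho.measure_pos μp ⟨0, ?_⟩).trans_le (measure_mono fun X (hX : entryNorm X < r) => hX.le)
  simpa [entryNorm_eq_zero_iff.2 rfl] using hr

omit [BorelSpace (Matrix (Fin n) (Fin n) F)] in
lemma measure_entryNorm_le_lt_top (r : ℝ) :
    μp {X : Matrix (Fin n) (Fin n) F | entryNorm X ≤ r} < ⊤ :=
  (isCompact_entryNorm_le r).measure_lt_top

omit [BorelSpace (Matrix (Fin n) (Fin n) F)] in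
lemma measureReal_entryNorm_le_pos {r : ℝ} (hr : 0 < r) :
    0 < μp.real {X : Matrix (Fin n) (Fin n) F | entryNorm X ≤ r} :=
  ENNReal.toReal_pos (measure_entryNorm_le_pos μp hr).ne' (measure_entryNorm_le_lt_top μp r).ne

lemma exists_map_mulLeft_eq_smul {A : Matrix (Fin n) (Fin n) F} (hA : A.det ≠ 0) :
    ∃ c : NNReal, μp.map (fun X => A * X) = c • μp := by
  have := secondCountableTopology_matrix (n := n) (F := F)
  have := locallyCompactSpace_matrix (n := n) (F := F)
  have h : (μp.map (mulLeftAddEquiv A hA)).IsAddHaarMeasure :=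
    AddEquiv.isAddHaarMeasure_map μp _ (continuous_mulLeft_matrix A) (continuous_mulLeft_matrix A⁻¹)
  exact ⟨_, Measure.isAddLeftInvariant_eq_smul (μp.map (mulLeftAddEquiv A hA)) μp⟩

lemma integral_map_inv_mul {g : Matrix (Fin n) (Fin n) F} (hg : g.det ≠ 0)
    (G : Matrix (Fin n) (Fin n) F → ℂ) :
    ∫ X, G (g⁻¹ * X) ∂μp = haarFactor μp g * ∫ X, G X ∂μp := by
  have hg' : g⁻¹.det ≠ 0 := by
    rw [Matrix.det_nonsing_inv, Ring.inverse_eq_inv']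
    exact inv_ne_zero hg
  obtain ⟨c, hc⟩ := exists_map_mulLeft_eq_smul μp hg'
  have hfac : haarFactor μp g = c := by
    rw [haarFactor, hc, measureReal_nnreal_smul_apply,
      mul_div_cancel_right₀ _ (measureReal_entryNorm_le_pos μp one_pos).ne']
  rw [← (measurableEmbedding_matrix_mulLeft hg').integral_map, hc, hfac, integral_smul_nnreal_measure]
  rfl

variable [IsUltrametricDist F]

lemma map_mulLeft_eq_self {k : Matrix (Fin n) (Fin n) F} (hk : entryNorm (k - 1) < 1) :
    μp.map (fun X => k * X) = μp := by
  have hk0 : k.det ≠ 0 := by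
    rw [← norm_pos_iff, norm_det_eq_one hk]
    exact one_pos
  obtain ⟨c, hc⟩ := exists_map_mulLeft_eq_smul μp hk0
  have h1 : μp {X | entryNorm X ≤ 1} = c • μp {X | entryNorm X ≤ 1} := by
    conv_rhs => rw [← Measure.smul_apply, ← hc,
      (measurableEmbedding_matrix_mulLeft hk0).map_apply, Set.preimage_ofPred_eq]
    simp only [entryNorm_mul_left hk]
  have hc1 : c = 1 := by
    have h2 := congrArg ENNReal.toReal h1
    rw [ENNReal.toReal_smul] at h2
    have h3 := measureReal_entryNorm_le_pos μp one_pos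
    rw [measureReal_def] at h3
    have h4 : (c : ℝ) = 1 := by
      have : (1 : ℝ) * _ = (c : ℝ) * _ := (one_mul _).trans h2
      exact (mul_right_cancel₀ h3.ne' this).symm
    exact_mod_cast h4
  rw [hc, hc1, one_smul]

lemma haarFactor_mul_left {k : Matrix (Fin n) (Fin n) F} (hk : entryNorm (k - 1) < 1)
    (g : Matrix (Fin n) (Fin n) F) : haarFactor μp (k * g) = haarFactor μp g := by
  have hk0 : k.det ≠ 0 := by
    rw [← norm_pos_iff, norm_det_eq_one hk]
    exact one_pos
  have h : μp.map (fun X => (k * g)⁻¹ * X) = μp.map (fun X => g⁻¹ * X) := by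
    conv_rhs => rw [← map_mulLeft_eq_self μp hk]
    conv_lhs => rw [← map_mulLeft_eq_self μp hk]
    rw [Measure.map_map (continuous_mulLeft_matrix _).measurable
      (continuous_mulLeft_matrix _).measurable, map_mulLeft_eq_self μp hk]
    congr 1
    ext1 X
    simp only [Function.comp_apply, Matrix.mul_inv_rev]
    rw [mul_assoc, Matrix.nonsing_inv_mul_cancel_left k X hk0.isUnit]
  rw [haarFactor, haarFactor, h]

omit [μp.IsAddHaarMeasure] [ProperSpace F] in
lemma haarFactor_mul_right {k : Matrix (Fin n) (Fin n) F} (hk : entryNorm (k - 1) < 1)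
    (g : Matrix (Fin n) (Fin n) F) : haarFactor μp (g * k) = haarFactor μp g := by
  have hk0 : k.det ≠ 0 := by
    rw [← norm_pos_iff, norm_det_eq_one hk]
    exact one_pos
  have h (Y : Matrix (Fin n) (Fin n) F) : entryNorm (k⁻¹ * Y) = entryNorm Y := by
    rw [← entryNorm_mul_left hk, Matrix.mul_nonsing_inv_cancel_left k Y hk0.isUnit]
  simp only [haarFactor_eq, Matrix.mul_inv_rev, mul_assoc, h]

end HaarScaling

section Convolution

variable {n : ℕ} {F : Type*} [NontriviallyNormedField F]

lemma mem_Kcong_iff {ϖ : F} {ℓ : ℤ} {g : Matrix (Fin n) (Fin n) F} :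
    g ∈ Kcong n ϖ ℓ ↔ entryNorm (g - 1) ≤ ‖ϖ‖ ^ ℓ := by
  rw [entryNorm_le_iff (zpow_nonneg (norm_nonneg _) _)]
  rfl

lemma entryNorm_sub_one_lt_one {ϖ : F} (hϖ0 : 0 < ‖ϖ‖) (hϖ1 : ‖ϖ‖ < 1) {ℓ : ℤ} (hℓ : 1 ≤ ℓ)
    {g : Matrix (Fin n) (Fin n) F} (hg : g ∈ Kcong n ϖ ℓ) : entryNorm (g - 1) < 1 :=
  (mem_Kcong_iff.1 hg).trans_lt <| by
    rw [← zpow_zero ‖ϖ‖]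
    exact zpow_lt_zpow_right_of_lt_one₀ hϖ0 hϖ1 (by omega)

/-- The factor relating `Φ_GJ * c_ℓ^∨` to the additive character on the large ball. -/
noncomputable def convFactor [MeasurableSpace (Matrix (Fin n) (Fin n) F)]
    (μp : Measure (Matrix (Fin n) (Fin n) F)) (g : Matrix (Fin n) (Fin n) F) : ℝ :=
  haarFactor μp g * (‖g.det‖ ^ ((n : ℝ) / 2) * (‖g.det‖ ^ n)⁻¹)

variable [MeasurableSpace (Matrix (Fin n) (Fin n) F)] [BorelSpace (Matrix (Fin n) (Fin n) F)]
  (μp : Measure (Matrix (Fin n) (Fin n) F)) [μp.IsAddHaarMeasure] [ProperSpace F]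
  [IsUltrametricDist F]

omit [μp.IsAddHaarMeasure] [ProperSpace F] in
lemma convFactor_mul_right {k : Matrix (Fin n) (Fin n) F} (hk : entryNorm (k - 1) < 1)
    (g : Matrix (Fin n) (Fin n) F) : convFactor μp (g * k) = convFactor μp g := by
  rw [convFactor, convFactor, haarFactor_mul_right μp hk, Matrix.det_mul, norm_mul,
    norm_det_eq_one hk, mul_one]

lemma convFactor_mul_left {k : Matrix (Fin n) (Fin n) F} (hk : entryNorm (k - 1) < 1)
    (g : Matrix (Fin n) (Fin n) F) : convFactor μp (k * g) = convFactor μp g := by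
  rw [convFactor, convFactor, haarFactor_mul_left μp hk, Matrix.det_mul, norm_mul,
    norm_det_eq_one hk, one_mul]

omit [ProperSpace F] in
lemma muGL_Kcong {ϖ : F} (hϖ0 : 0 < ‖ϖ‖) (hϖ1 : ‖ϖ‖ < 1) {ℓ : ℤ} (hℓ : 1 ≤ ℓ) :
    muGL n μp (Kcong n ϖ ℓ) = μp {X | entryNorm X ≤ ‖ϖ‖ ^ ℓ} := by
  have hK : Kcong n ϖ ℓ = (fun X : Matrix (Fin n) (Fin n) F => -1 + X) ⁻¹'
      {X | entryNorm X ≤ ‖ϖ‖ ^ ℓ} := by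
    ext X
    rw [mem_Kcong_iff, sub_eq_neg_add]
    rfl
  have hm : MeasurableSet (Kcong n ϖ ℓ : Set (Matrix (Fin n) (Fin n) F)) := by
    rw [hK]
    exact (continuous_const.add continuous_id).measurable (measurableSet_entryNorm_le _)
  rw [muGL, withDensity_apply _ hm]
  have h1 : ∫⁻ g in Kcong n ϖ ℓ, ENNReal.ofReal ((‖g.det‖ ^ n)⁻¹) ∂μp
      = ∫⁻ g in Kcong n ϖ ℓ, 1 ∂μp := by
    refine setLIntegral_congr_fun hm fun g hg => ?_
    simp only [norm_det_eq_one (entryNorm_sub_one_lt_one hϖ0 hϖ1 hℓ hg), one_pow, inv_one,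
      ENNReal.ofReal_one]
  rw [h1, setLIntegral_one, hK, measure_preimage_add]

omit [ProperSpace F] in
lemma integral_char_trace_mul {ϖ : F} (hϖ0 : 0 < ‖ϖ‖) (hϖ1 : ‖ϖ‖ < 1)
    (hdisc : ∀ x : F, x ≠ 0 → ∃ k : ℤ, ‖x‖ = ‖ϖ‖ ^ k)
    {ψ : F → ℂ} (hψadd : ∀ x y : F, ψ (x + y) = ψ x * ψ y)
    (hψtriv : ∀ x : F, ‖x‖ ≤ 1 → ψ x = 1)
    (hψnontriv : ∃ x : F, ‖x‖ ≤ ‖ϖ‖⁻¹ ∧ ψ x ≠ 1) (ℓ : ℤ) (g : Matrix (Fin n) (Fin n) F) :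
    ∫ Y, {X | entryNorm X ≤ ‖ϖ‖ ^ ℓ}.indicator (fun X => ψ (g * X).trace) Y ∂μp =
      {h | entryNorm h ≤ ‖ϖ‖ ^ (-ℓ)}.indicator
        (fun _ => (μp.real {X | entryNorm X ≤ ‖ϖ‖ ^ ℓ} : ℂ)) g := by
  have hℓpos : 0 < ‖ϖ‖ ^ ℓ := zpow_pos hϖ0 _
  by_cases hg : entryNorm g ≤ ‖ϖ‖ ^ (-ℓ)
  · rw [Set.indicator_of_mem (by exact hg), integral_indicator (measurableSet_entryNorm_le _)]
    have h1 : ∫ Y in {X | entryNorm X ≤ ‖ϖ‖ ^ ℓ}, ψ (g * Y).trace ∂μp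
        = ∫ Y in {X | entryNorm X ≤ ‖ϖ‖ ^ ℓ}, (1 : ℂ) ∂μp := by
      refine setIntegral_congr_fun (measurableSet_entryNorm_le _) fun Y hY => hψtriv _ ?_
      calc ‖(g * Y).trace‖ ≤ entryNorm g * entryNorm Y :=
            (norm_trace_le_entryNorm _).trans (entryNorm_mul_le _ _)
        _ ≤ ‖ϖ‖ ^ (-ℓ) * ‖ϖ‖ ^ ℓ :=
            mul_le_mul hg hY (entryNorm_nonneg _) (zpow_nonneg hϖ0.le _)
        _ = 1 := by rw [← zpow_add₀ hϖ0.ne', neg_add_cancel, zpow_zero]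
    rw [h1]
    simp
  · rw [Set.indicator_of_notMem (by exact hg)]
    obtain ⟨i, j, hij⟩ : ∃ i j, ‖ϖ‖ ^ (-ℓ) < ‖g i j‖ := by
      rw [entryNorm_le_iff (zpow_nonneg hϖ0.le _)] at hg
      push Not at hg
      exact hg
    obtain ⟨t, ht, hψt⟩ := exists_char_mul_ne_one hϖ0 hϖ1 hdisc hψnontriv hij
    set Y₀ : Matrix (Fin n) (Fin n) F := Matrix.single j i t with hY₀
    have hY₀n : entryNorm Y₀ ≤ ‖ϖ‖ ^ ℓ := by
      rw [entryNorm_le_iff hℓpos.le]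
      intro a b
      rw [hY₀, Matrix.single_apply]
      split_ifs
      · exact ht
      · simpa using hℓpos.le
    have htr : (g * Y₀).trace = t * g i j := by
      rw [hY₀, Matrix.trace_mul_single, mul_comm, op_smul_eq_mul]
    have hmem : ∀ Y : Matrix (Fin n) (Fin n) F,
        entryNorm (Y₀ + Y) ≤ ‖ϖ‖ ^ ℓ ↔ entryNorm Y ≤ ‖ϖ‖ ^ ℓ := by
      intro Y
      refine ⟨fun h => ?_, fun h => (entryNorm_add_le_max _ _).trans (max_le hY₀n h)⟩
      have hneg : entryNorm (-Y₀) ≤ ‖ϖ‖ ^ ℓ := by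
        rw [← neg_one_smul F, entryNorm_smul]
        simpa using hY₀n
      have := (entryNorm_add_le_max (-Y₀) (Y₀ + Y)).trans (max_le hneg h)
      rwa [neg_add_cancel_left] at this
    set I := ∫ Y, {X | entryNorm X ≤ ‖ϖ‖ ^ ℓ}.indicator (fun X => ψ (g * X).trace) Y ∂μp with hI
    have hII : I = ψ (t * g i j) * I := by
      conv_lhs => rw [hI, ← integral_add_left_eq_self _ Y₀]
      rw [hI, ← integral_const_mul]
      congr 1
      ext Y
      by_cases hY : entryNorm Y ≤ ‖ϖ‖ ^ ℓ
      · rw [Set.indicator_of_mem (by exact (hmem Y).2 hY), Set.indicator_of_mem (by exact hY),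
          mul_add, Matrix.trace_add, hψadd, htr]
      · rw [Set.indicator_of_notMem (by exact fun h => hY ((hmem Y).1 h)),
          Set.indicator_of_notMem (by exact hY), mul_zero]
    by_contra hI0
    exact hψt (mul_right_cancel₀ hI0 (hII.symm.trans (one_mul I).symm))

/-- Away from singular matrices, `Φ_GJ * c_ℓ^∨` is the additive character of the trace, truncated
to the ball of radius `‖ϖ‖ ^ (-ℓ)`, up to a factor independent of `ℓ`. -/
lemma convGJ_cFun {ϖ : F} (hϖ0 : 0 < ‖ϖ‖) (hϖ1 : ‖ϖ‖ < 1)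
    (hdisc : ∀ x : F, x ≠ 0 → ∃ k : ℤ, ‖x‖ = ‖ϖ‖ ^ k)
    {ψ : F → ℂ} (hψadd : ∀ x y : F, ψ (x + y) = ψ x * ψ y)
    (hψtriv : ∀ x : F, ‖x‖ ≤ 1 → ψ x = 1)
    (hψnontriv : ∃ x : F, ‖x‖ ≤ ‖ϖ‖⁻¹ ∧ ψ x ≠ 1) {ℓ : ℤ} (hℓ : 1 ≤ ℓ)
    {g : Matrix (Fin n) (Fin n) F} (hg : g.det ≠ 0) :
    convGJ n μp ψ (cFun n μp ϖ ℓ) g =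
      {h | entryNorm h ≤ ‖ϖ‖ ^ (-ℓ)}.indicator (fun h => ψ h.trace * convFactor μp h) g := by
  set V : ℝ := μp.real {X : Matrix (Fin n) (Fin n) F | entryNorm X ≤ ‖ϖ‖ ^ ℓ} with hV
  have hV0 : (V : ℂ) ≠ 0 :=
    Complex.ofReal_ne_zero.2 (measureReal_entryNorm_le_pos μp (zpow_pos hϖ0 _)).ne'
  have hc : cFun n μp ϖ ℓ = (Kcong n ϖ ℓ).indicator fun _ => (V : ℂ)⁻¹ := by
    rw [cFun, muGL_Kcong μp hϖ0 hϖ1 hℓ]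
    rfl
  have hcd : Continuous fun g : Matrix (Fin n) (Fin n) F => ‖g.det‖ :=
    continuous_norm.comp (continuous_id.matrix_det)
  have hmd : Measurable fun g : Matrix (Fin n) (Fin n) F => ENNReal.ofReal ((‖g.det‖ ^ n)⁻¹) :=
    ((hcd.measurable.pow_const n).inv).ennreal_ofReal
  rw [convGJ, muGL, integral_withDensity_eq_integral_toReal_smul hmd
    (Filter.Eventually.of_forall fun _ => ENNReal.ofReal_lt_top)]
  set G : Matrix (Fin n) (Fin n) F → ℂ := fun k =>
    ((‖(g * k).det‖ ^ n)⁻¹ : ℝ) • (PhiGJ n ψ (g * k) * cFun n μp ϖ ℓ k) with hG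
  have h1 : (fun h => (ENNReal.ofReal ((‖h.det‖ ^ n)⁻¹)).toReal •
      (PhiGJ n ψ h * cFun n μp ϖ ℓ (g⁻¹ * h))) = fun h => G (g⁻¹ * h) := by
    ext h
    rw [hG]
    simp only
    rw [Matrix.mul_nonsing_inv_cancel_left g h hg.isUnit, ENNReal.toReal_ofReal (by positivity)]
  rw [h1, integral_map_inv_mul μp hg, ← integral_add_left_eq_self _ 1]
  have h2 : (fun Y => G (1 + Y)) = fun Y =>
      (((‖g.det‖ ^ ((n : ℝ) / 2) * (‖g.det‖ ^ n)⁻¹ : ℝ) : ℂ) * ψ g.trace * (V : ℂ)⁻¹) *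
      {X | entryNorm X ≤ ‖ϖ‖ ^ ℓ}.indicator (fun X => ψ (g * X).trace) Y := by
    ext Y
    by_cases hY : entryNorm Y ≤ ‖ϖ‖ ^ ℓ
    · have hK : 1 + Y ∈ Kcong n ϖ ℓ := by
        rw [mem_Kcong_iff, add_sub_cancel_left]
        exact hY
      rw [Set.indicator_of_mem (by exact hY), hG]
      simp only
      rw [hc, Set.indicator_of_mem hK, PhiGJ, Matrix.det_mul, norm_mul,
        norm_det_eq_one (entryNorm_sub_one_lt_one hϖ0 hϖ1 hℓ hK), mul_one, mul_add, mul_one,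
        Matrix.trace_add, hψadd, Complex.real_smul]
      push_cast
      ring
    · have hK : 1 + Y ∉ Kcong n ϖ ℓ := by
        rw [mem_Kcong_iff, add_sub_cancel_left]
        exact hY
      rw [Set.indicator_of_notMem (by exact hY), hG]
      simp only
      rw [hc, Set.indicator_of_notMem hK, mul_zero, smul_zero, mul_zero]
  rw [h2, integral_const_mul,
    integral_char_trace_mul μp hϖ0 hϖ1 hdisc hψadd hψtriv hψnontriv]
  by_cases hg' : entryNorm g ≤ ‖ϖ‖ ^ (-ℓ)
  · rw [Set.indicator_of_mem (by exact hg'), Set.indicator_of_mem (by exact hg'), convFactor]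
    push_cast
    rw [← hV]
    field_simp
  · rw [Set.indicator_of_notMem (by exact hg'), Set.indicator_of_notMem (by exact hg'), mul_zero,
      mul_zero]

end Convolution

section Vanishing

variable {F : Type*} [NontriviallyNormedField F]

/-- Averaging a nontrivial additive character over a ball gives zero. -/
lemma setIntegral_char_mul_eq_zero [IsUltrametricDist F] [MeasurableSpace F] [BorelSpace F]
    (η : Measure F) [η.IsAddHaarMeasure] {ψ : F → ℂ}
    (hψadd : ∀ x y : F, ψ (x + y) = ψ x * ψ y) {r : ℝ} {y : F}
    (hy : ∃ t : F, ‖t‖ ≤ r ∧ ψ (t * y) ≠ 1) :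
    ∫ t in Metric.closedBall (0 : F) r, ψ (t * y) ∂η = 0 := by
  obtain ⟨t₀, ht₀, hne⟩ := hy
  have hm : MeasurableSet (Metric.closedBall (0 : F) r) := Metric.isClosed_closedBall.measurableSet
  rw [← integral_indicator hm]
  set I := ∫ t, (Metric.closedBall (0 : F) r).indicator (fun t => ψ (t * y)) t ∂η with hI
  have hmem : ∀ t : F, t₀ + t ∈ Metric.closedBall (0 : F) r ↔ t ∈ Metric.closedBall (0 : F) r := by
    intro t
    simp only [mem_closedBall_zero_iff]
    refine ⟨fun h => ?_, fun h => (IsUltrametricDist.norm_add_le_max _ _).trans (max_le ht₀ h)⟩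
    have := (IsUltrametricDist.norm_add_le_max (-t₀) (t₀ + t)).trans
      (max_le ((norm_neg t₀).le.trans ht₀) h)
    rwa [neg_add_cancel_left] at this
  have hII : I = ψ (t₀ * y) * I := by
    conv_lhs => rw [hI, ← integral_add_left_eq_self _ t₀]
    rw [hI, ← integral_const_mul]
    congr 1
    ext t
    by_cases ht : t ∈ Metric.closedBall (0 : F) r
    · rw [Set.indicator_of_mem ((hmem t).2 ht), Set.indicator_of_mem ht, add_mul, hψadd]
    · rw [Set.indicator_of_notMem (fun h => ht ((hmem t).1 h)), Set.indicator_of_notMem ht,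
        mul_zero]
  by_contra hI0
  exact hne (mul_right_cancel₀ hI0 (hII.symm.trans (one_mul I).symm))

variable [ProperSpace F] [IsUltrametricDist F] [MeasurableSpace F] [BorelSpace F] {n : ℕ}
  [MeasurableSpace (Matrix (Fin n) (Fin n) F)] [BorelSpace (Matrix (Fin n) (Fin n) F)]

/-- If a set is stable under the one-parameter family `1 + t • N`, and the character
`t ↦ ψ (t * tr (N * g))` is nontrivial for all of its elements `g`, then the integral over this set
of `ψ (tr g)` against an invariant function vanishes. -/
lemma setIntegral_char_trace_eq_zero {ψ : F → ℂ} (hψc : Continuous ψ)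
    (hψadd : ∀ x y : F, ψ (x + y) = ψ x * ψ y) {ν : Measure (Matrix (Fin n) (Fin n) F)}
    {U : Set (Matrix (Fin n) (Fin n) F)} (hUm : MeasurableSet U) (hUfin : ν U < ⊤)
    {R : ℝ} (hUR : ∀ g ∈ U, entryNorm g ≤ R) {N : Matrix (Fin n) (Fin n) F}
    (hN : entryNorm N ≤ 1) {r : ℝ} (hr : 0 < r) (hdet : ∀ t : F, (1 + t • N).det = 1)
    (hν : ∀ t : F, ‖t‖ ≤ r → ν.map (fun h => (1 + t • N) * h) = ν)
    (hU : ∀ t : F, ‖t‖ ≤ r → ∀ g, (1 + t • N) * g ∈ U ↔ g ∈ U)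
    {χ : Matrix (Fin n) (Fin n) F → ℂ}
    (hχ : ∀ t : F, ‖t‖ ≤ r → ∀ g, χ ((1 + t • N) * g) = χ g)
    (hint : IntegrableOn (fun g => ψ g.trace * χ g) U ν)
    (hchar : ∀ g ∈ U, ∃ t : F, ‖t‖ ≤ r ∧ ψ (t * (N * g).trace) ≠ 1) :
    ∫ g in U, ψ g.trace * χ g ∂ν = 0 := by
  have := secondCountableTopology_matrix (n := n) (F := F)
  set η : Measure F := Measure.addHaar
  set B : Set F := Metric.closedBall 0 r with hB
  have hBm : MeasurableSet B := Metric.isClosed_closedBall.measurableSet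
  have hBtop : η B < ⊤ := (isCompact_closedBall 0 r).measure_lt_top
  have hBpos : 0 < η B := Metric.measure_closedBall_pos η 0 hr
  have hfinB : IsFiniteMeasure (η.restrict B) := ⟨by rwa [Measure.restrict_apply_univ]⟩
  have hfinU : IsFiniteMeasure (ν.restrict U) := ⟨by rwa [Measure.restrict_apply_univ]⟩
  set f : Matrix (Fin n) (Fin n) F → ℂ := fun g => ψ g.trace * χ g with hf
  have hshift : ∀ t ∈ B, ∫ g in U, ψ (t * (N * g).trace) * f g ∂ν = ∫ g in U, f g ∂ν := by
    intro t ht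
    rw [hB, mem_closedBall_zero_iff] at ht
    have hk : (1 + t • N).det ≠ 0 := by rw [hdet]; exact one_ne_zero
    conv_rhs => rw [← integral_indicator hUm, ← hν t ht,
      (measurableEmbedding_matrix_mulLeft hk).integral_map]
    rw [← integral_indicator hUm]
    congr 1
    ext g
    by_cases hg : g ∈ U
    · rw [Set.indicator_of_mem hg, Set.indicator_of_mem ((hU t ht g).2 hg), hf]
      simp only
      rw [hχ t ht, add_mul, one_mul, Matrix.trace_add, hψadd, Matrix.smul_mul, Matrix.trace_smul,
        smul_eq_mul]
      ring
    · rw [Set.indicator_of_notMem hg, Set.indicator_of_notMem fun h => hg ((hU t ht g).1 h)]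
  have hψcont : Continuous fun p : F × Matrix (Fin n) (Fin n) F => ψ (p.1 * (N * p.2).trace) :=
    hψc.comp (continuous_fst.mul (continuous_const.matrix_mul continuous_snd).matrix_trace)
  obtain ⟨C, hC⟩ := (isCompact_closedBall (0 : F) (r * R)).exists_bound_of_continuousOn
    hψc.continuousOn
  have hprod : Integrable (Function.uncurry fun (t : F) (g : Matrix (Fin n) (Fin n) F) =>
      ψ (t * (N * g).trace) * f g) ((η.restrict B).prod (ν.restrict U)) := by
    have h1 : Integrable (fun p : F × Matrix (Fin n) (Fin n) F => f p.2)
        ((η.restrict B).prod (ν.restrict U)) := Integrable.comp_snd hint _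
    refine h1.bdd_mul (c := C) hψcont.aestronglyMeasurable ?_
    filter_upwards [Measure.quasiMeasurePreserving_fst.ae (ae_restrict_mem hBm),
      Measure.quasiMeasurePreserving_snd.ae (ae_restrict_mem hUm)] with p hp1 hp2
    refine hC _ ?_
    rw [hB, mem_closedBall_zero_iff] at hp1
    rw [mem_closedBall_zero_iff, norm_mul]
    refine mul_le_mul hp1 ?_ (norm_nonneg _) hr.le
    calc ‖(N * p.2).trace‖ ≤ entryNorm N * entryNorm p.2 :=
          (norm_trace_le_entryNorm _).trans (entryNorm_mul_le _ _)
      _ ≤ 1 * R := mul_le_mul hN (hUR _ hp2) (entryNorm_nonneg _) zero_le_one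
      _ = R := one_mul R
  have hswap := integral_integral_swap hprod
  rw [setIntegral_congr_fun hBm hshift] at hswap
  have hzero : ∫ g in U, ∫ t in B, ψ (t * (N * g).trace) * f g ∂η ∂ν = 0 := by
    rw [setIntegral_congr_fun hUm (g := fun _ => 0)]
    · simp
    · intro g hg
      simp only
      rw [integral_mul_const, setIntegral_char_mul_eq_zero η hψadd (hchar g hg), zero_mul]
  rw [hzero, setIntegral_const, smul_eq_zero] at hswap
  exact hswap.resolve_left (ENNReal.toReal_pos hBpos.ne' hBtop.ne).ne'

end Vanishing

section SquareZeroFamily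

variable {n : ℕ} {F : Type*} [NontriviallyNormedField F]

/-- A finite family of rank one square-zero matrices, namely the elementary matrices `e_b e_aᵀ` and
the matrices `(e_a + e_b) (e_a - e_b)ᵀ`, for `a ≠ b`. -/
noncomputable def sqZeroMatrix (F : Type*) [NontriviallyNormedField F]
    (p : (Fin n × Fin n) × Bool) : Matrix (Fin n) (Fin n) F :=
  if p.1.1 = p.1.2 then 0 else
    if p.2 then
      vecMulVec (Pi.single p.1.1 1 + Pi.single p.1.2 1) (Pi.single p.1.1 1 - Pi.single p.1.2 1)
    else vecMulVec (Pi.single p.1.2 1) (Pi.single p.1.1 1)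

lemma det_one_add_smul_vecMulVec {u v : Fin n → F} (h : v ⬝ᵥ u = 0) (t : F) :
    (1 + t • vecMulVec u v).det = 1 := by
  rw [← Matrix.smul_vecMulVec, Matrix.vecMulVec_eq Unit,
    Matrix.det_one_add_replicateCol_mul_replicateRow, dotProduct_smul, h, smul_zero, add_zero]

lemma det_one_add_smul_sqZeroMatrix (p : (Fin n × Fin n) × Bool) (t : F) :
    (1 + t • sqZeroMatrix F p).det = 1 := by
  rw [sqZeroMatrix]
  split_ifs with h1 h2
  · simp
  · refine det_one_add_smul_vecMulVec ?_ t
    simp [h1, Ne.symm h1]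
  · refine det_one_add_smul_vecMulVec ?_ t
    simp [h1]

lemma trace_sqZeroMatrix_false_mul {a b : Fin n} (hab : a ≠ b) (g : Matrix (Fin n) (Fin n) F) :
    (sqZeroMatrix F ((a, b), false) * g).trace = g a b := by
  simp [sqZeroMatrix, hab, Matrix.vecMulVec_mul, Matrix.trace_vecMulVec]

lemma trace_sqZeroMatrix_true_mul {a b : Fin n} (hab : a ≠ b) (g : Matrix (Fin n) (Fin n) F) :
    (sqZeroMatrix F ((a, b), true) * g).trace = g a a + g a b - g b a - g b b := by
  simp [sqZeroMatrix, hab, Matrix.vecMulVec_mul, Matrix.trace_vecMulVec, Matrix.sub_vecMul]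
  ring

variable [IsUltrametricDist F]

lemma entryNorm_sqZeroMatrix_le (p : (Fin n × Fin n) × Bool) :
    entryNorm (sqZeroMatrix F p) ≤ 1 := by
  have hs : ∀ a i : Fin n, ‖(Pi.single a 1 : Fin n → F) i‖ ≤ 1 := by
    intro a i
    rw [Pi.single_apply]
    split_ifs <;> simp
  rw [entryNorm_le_iff zero_le_one]
  intro i j
  rw [sqZeroMatrix]
  split_ifs
  · simp
  · rw [Matrix.vecMulVec_apply, norm_mul]
    refine mul_le_one₀ ?_ (norm_nonneg _) ?_
    · exact (IsUltrametricDist.norm_add_le_max _ _).trans (max_le (hs _ _) (hs _ _))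
    · rw [Pi.sub_apply, sub_eq_add_neg]
      refine (IsUltrametricDist.norm_add_le_max _ _).trans (max_le (hs _ _) ?_)
      rw [norm_neg]
      exact hs _ _
  · rw [Matrix.vecMulVec_apply, norm_mul]
    exact mul_le_one₀ (hs _ _) (norm_nonneg _) (hs _ _)

lemma norm_trace_mul_le {N : Matrix (Fin n) (Fin n) F} (hN : entryNorm N ≤ 1)
    (g : Matrix (Fin n) (Fin n) F) : ‖(N * g).trace‖ ≤ entryNorm g :=
  ((norm_trace_le_entryNorm _).trans (entryNorm_mul_le _ _)).trans
    (mul_le_of_le_one_left (entryNorm_nonneg _) hN)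

lemma exists_norm_trace_sqZeroMatrix_mul_eq [NeZero n] {g : Matrix (Fin n) (Fin n) F}
    (hg : g ≠ 0) (hdet : ‖g.det‖ ≠ entryNorm g ^ n) :
    ∃ p, ‖(sqZeroMatrix F p * g).trace‖ = entryNorm g := by
  by_contra! h
  have h' : ∀ p, ‖(sqZeroMatrix F p * g).trace‖ < entryNorm g := fun p =>
    (norm_trace_mul_le (entryNorm_sqZeroMatrix_le p) g).lt_of_ne (h p)
  refine hdet (norm_det_eq_entryNorm_pow hg (fun a b hab => ?_) fun a b hab => ?_)
  · rw [← trace_sqZeroMatrix_false_mul hab g]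
    exact h' _
  · rw [← trace_sqZeroMatrix_true_mul hab g]
    exact h' _

lemma norm_trace_mul_mul_left_eq_iff {N k : Matrix (Fin n) (Fin n) F} (hN : entryNorm N ≤ 1)
    (hk : entryNorm (k - 1) < 1) (g : Matrix (Fin n) (Fin n) F) :
    ‖(N * (k * g)).trace‖ = entryNorm (k * g) ↔ ‖(N * g).trace‖ = entryNorm g := by
  rcases eq_or_ne g 0 with rfl | hg
  · simp
  have hpos : 0 < entryNorm g :=
    (entryNorm_nonneg g).lt_of_ne fun h => hg (entryNorm_eq_zero_iff.1 h.symm)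
  have hkg : (N * (k * g)).trace = (N * g).trace + (N * ((k - 1) * g)).trace := by
    rw [← Matrix.trace_add, ← mul_add, sub_mul, one_mul]
    congr 2
    abel
  have hlt : ‖(N * ((k - 1) * g)).trace‖ < entryNorm g :=
    ((norm_trace_mul_le hN _).trans (entryNorm_mul_le _ _)).trans_lt
      ((mul_lt_iff_lt_one_left hpos).2 hk)
  rw [entryNorm_mul_left hk, hkg]
  refine ⟨fun h => ?_, fun h => ?_⟩
  · by_contra hne
    have := (norm_trace_mul_le hN g).lt_of_ne hne
    exact ((IsUltrametricDist.norm_add_le_max _ _).trans_lt (max_lt this hlt)).ne h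
  · rw [norm_add_eq_of_lt (by rwa [h]), h]

end SquareZeroFamily

section Stabilization

variable {n : ℕ} {F : Type*} [NontriviallyNormedField F] [ProperSpace F] [IsUltrametricDist F]
  [MeasurableSpace F] [BorelSpace F]
  [MeasurableSpace (Matrix (Fin n) (Fin n) F)] [BorelSpace (Matrix (Fin n) (Fin n) F)]
  {ϖ : F} (hϖ0 : 0 < ‖ϖ‖) (hϖ1 : ‖ϖ‖ < 1)
  (hdisc : ∀ x : F, x ≠ 0 → ∃ k : ℤ, ‖x‖ = ‖ϖ‖ ^ k)
  {ψ : F → ℂ} (hψc : Continuous ψ) (hψadd : ∀ x y : F, ψ (x + y) = ψ x * ψ y)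
  (hψnontriv : ∃ x : F, ‖x‖ ≤ ‖ϖ‖⁻¹ ∧ ψ x ≠ 1)
  {ν : Measure (Matrix (Fin n) (Fin n) F)} [IsFiniteMeasureOnCompacts ν]
  (hν : ∀ s : Matrix (Fin n) (Fin n) F, s.det = 1 → ν.map (fun h => s * h) = ν)
  {n₀ : ℤ} (hn₀ : 1 ≤ n₀) {χ : Matrix (Fin n) (Fin n) F → ℂ}
  (hχ : ∀ k ∈ Kcong n ϖ n₀, ∀ g, χ (k * g) = χ g)

include hϖ0 hϖ1 hdisc hψc hψadd hψnontriv hν hn₀ hχ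

lemma setIntegral_char_trace_eq_zero_of_cover (s : Finset ((Fin n × Fin n) × Bool))
    {R : ℝ} (U : Set (Matrix (Fin n) (Fin n) F)) (hUm : MeasurableSet U)
    (hUR : ∀ g ∈ U, entryNorm g ≤ R) (hUbig : ∀ g ∈ U, ‖ϖ‖ ^ (-n₀) < entryNorm g)
    (hU : ∀ k ∈ Kcong n ϖ n₀, k.det = 1 → ∀ g, k * g ∈ U ↔ g ∈ U)
    (hint : IntegrableOn (fun g => ψ g.trace * χ g) U ν)
    (hcov : ∀ g ∈ U, ∃ p ∈ s, ‖(sqZeroMatrix F p * g).trace‖ = entryNorm g) :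
    ∫ g in U, ψ g.trace * χ g ∂ν = 0 := by
  induction s using Finset.induction_on generalizing U with
  | empty =>
    have : U = ∅ := Set.eq_empty_of_forall_notMem fun g hg => by simpa using hcov g hg
    rw [this, setIntegral_empty]
  | insert p s hps ih =>
    set A : Set (Matrix (Fin n) (Fin n) F) :=
      {g | ‖(sqZeroMatrix F p * g).trace‖ = entryNorm g} with hA
    have hAm : MeasurableSet A :=
      (isClosed_eq (continuous_norm.comp (continuous_mulLeft_matrix _).matrix_trace)
        continuous_entryNorm).measurableSet
    have hAinv : ∀ k ∈ Kcong n ϖ n₀, ∀ g, k * g ∈ A ↔ g ∈ A := fun k hk g =>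
      norm_trace_mul_mul_left_eq_iff (entryNorm_sqZeroMatrix_le p)
        (entryNorm_sub_one_lt_one hϖ0 hϖ1 hn₀ hk) g
    rw [← integral_inter_add_sdiff hAm hint]
    have h2 : ∫ g in U \ A, ψ g.trace * χ g ∂ν = 0 := by
      refine ih (U \ A) (hUm.diff hAm) (fun g hg => hUR g hg.1) (fun g hg => hUbig g hg.1)
        (fun k hk hk1 g => ?_) (hint.mono_set Set.sdiff_subset) fun g hg => ?_
      · rw [Set.mem_sdiff, Set.mem_sdiff, hU k hk hk1, hAinv k hk]
      · obtain ⟨q, hq, hqe⟩ := hcov g hg.1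
        rcases Finset.mem_insert.1 hq with rfl | hq
        · exact absurd hqe hg.2
        · exact ⟨q, hq, hqe⟩
    have hmem : ∀ t : F, ‖t‖ ≤ ‖ϖ‖ ^ n₀ → 1 + t • sqZeroMatrix F p ∈ Kcong n ϖ n₀ := by
      intro t ht
      rw [mem_Kcong_iff, add_sub_cancel_left, entryNorm_smul]
      exact (mul_le_of_le_one_right (norm_nonneg _) (entryNorm_sqZeroMatrix_le p)).trans ht
    have h1 : ∫ g in U ∩ A, ψ g.trace * χ g ∂ν = 0 := by
      have hfin : ν (U ∩ A) < ⊤ :=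
        (measure_mono fun g hg => hUR g hg.1).trans_lt (isCompact_entryNorm_le R).measure_lt_top
      refine setIntegral_char_trace_eq_zero hψc hψadd (hUm.inter hAm) hfin
        (fun g hg => hUR g hg.1) (entryNorm_sqZeroMatrix_le p) (zpow_pos hϖ0 n₀)
        (det_one_add_smul_sqZeroMatrix p) (fun t _ => hν _ (det_one_add_smul_sqZeroMatrix p t))
        (fun t ht g => ?_) (fun t ht g => hχ _ (hmem t ht) g)
        (hint.mono_set Set.inter_subset_left) fun g hg => ?_
      · rw [Set.mem_inter_iff, Set.mem_inter_iff,
          hU _ (hmem t ht) (det_one_add_smul_sqZeroMatrix p t), hAinv _ (hmem t ht)]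
      · refine exists_char_mul_ne_one hϖ0 hϖ1 hdisc hψnontriv ?_
        rw [show ‖(sqZeroMatrix F p * g).trace‖ = entryNorm g from hg.2]
        exact hUbig g hg.1
    rw [h1, h2, add_zero]

/-- On a fiber of the determinant, the integrals of an invariant function against `ψ (tr g)` over
balls stabilize once the radius of the ball is large. -/
lemma setIntegral_char_trace_ball_eq [NeZero n] {x : F} (hνx : ν {g | g.det ≠ x} = 0) {L ℓ : ℤ}
    (hL : n₀ ≤ L) (hxL : ‖x‖ ≤ ‖ϖ‖ ^ (-L)) (hℓ : L ≤ ℓ)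
    (hint : IntegrableOn (fun g => ψ g.trace * χ g) {g | entryNorm g ≤ ‖ϖ‖ ^ (-ℓ)} ν) :
    ∫ g in {g | entryNorm g ≤ ‖ϖ‖ ^ (-ℓ)}, ψ g.trace * χ g ∂ν =
      ∫ g in {g | entryNorm g ≤ ‖ϖ‖ ^ (-L)}, ψ g.trace * χ g ∂ν := by
  have hLℓ : ‖ϖ‖ ^ (-L) ≤ ‖ϖ‖ ^ (-ℓ) := zpow_le_zpow_right_of_le_one₀ hϖ0 hϖ1.le (by omega)
  have hn₀L : ‖ϖ‖ ^ (-n₀) ≤ ‖ϖ‖ ^ (-L) := zpow_le_zpow_right_of_le_one₀ hϖ0 hϖ1.le (by omega)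
  have hL1 : 1 ≤ ‖ϖ‖ ^ (-L) := by
    rw [← zpow_zero ‖ϖ‖]
    exact zpow_le_zpow_right_of_le_one₀ hϖ0 hϖ1.le (by omega)
  set E : Set (Matrix (Fin n) (Fin n) F) := {g | entryNorm g ≤ ‖ϖ‖ ^ (-ℓ)} with hE
  set E' : Set (Matrix (Fin n) (Fin n) F) := {g | entryNorm g ≤ ‖ϖ‖ ^ (-L)} with hE'
  set D : Set (Matrix (Fin n) (Fin n) F) := {g | g.det = x} with hD
  have hEm : MeasurableSet E := measurableSet_entryNorm_le _
  have hE'm : MeasurableSet E' := measurableSet_entryNorm_le _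
  have hDm : MeasurableSet D :=
    (isClosed_eq continuous_id.matrix_det continuous_const).measurableSet
  have hEE : E ∩ E' = E' := Set.inter_eq_right.2 fun g (hg : entryNorm g ≤ _) => hg.trans hLℓ
  have hae : (E \ E' : Set (Matrix (Fin n) (Fin n) F)) =ᵐ[ν] ((E \ E') ∩ D : Set _) := by
    have hDae : ∀ᵐ g ∂ν, g ∈ D := hνx
    filter_upwards [hDae] with g hg
    exact propext ⟨fun h => ⟨h, hg⟩, fun h => h.1⟩
  have hzero : ∫ g in (E \ E') ∩ D, ψ g.trace * χ g ∂ν = 0 := by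
    have hbig : ∀ g ∈ (E \ E') ∩ D, ‖ϖ‖ ^ (-L) < entryNorm g := fun g hg => not_le.1 hg.1.2
    refine setIntegral_char_trace_eq_zero_of_cover hϖ0 hϖ1 hdisc hψc hψadd hψnontriv hν hn₀ hχ
      Finset.univ _ ((hEm.diff hE'm).inter hDm) (fun g hg => hg.1.1)
      (fun g hg => hn₀L.trans_lt (hbig g hg)) (fun k hk hk1 g => ?_)
      (hint.mono_set fun g hg => hg.1.1) fun g hg => ?_
    · have hk' := entryNorm_sub_one_lt_one hϖ0 hϖ1 hn₀ hk
      simp only [hE, hE', hD, Set.mem_inter_iff, Set.mem_sdiff, Set.mem_ofPred_eq,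
        entryNorm_mul_left hk', Matrix.det_mul, hk1, one_mul]
    · have hg1 := hbig g hg
      have hg0 : g ≠ 0 := by
        rintro rfl
        rw [entryNorm_eq_zero_iff.2 rfl] at hg1
        exact (zpow_pos hϖ0 _).not_gt hg1
      obtain ⟨p, hp⟩ := exists_norm_trace_sqZeroMatrix_mul_eq hg0 (by
        refine ne_of_lt ?_
        calc ‖g.det‖ = ‖x‖ := by rw [show g.det = x from hg.2]
          _ ≤ ‖ϖ‖ ^ (-L) := hxL
          _ < entryNorm g := hg1
          _ ≤ entryNorm g ^ n := le_self_pow₀ (hL1.trans hg1.le) (NeZero.ne n))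
      exact ⟨p, Finset.mem_univ _, hp⟩
  rw [← integral_inter_add_sdiff hE'm hint, hEE, setIntegral_congr_set hae, hzero, add_zero]

end Stabilization

section FiberIntegral

variable {n : ℕ} {F : Type*} [NontriviallyNormedField F]

lemma det_t1_ne_zero (n : ℕ) {x : F} (hx : x ≠ 0) : (t1 n x).det ≠ 0 := by
  rw [t1, Matrix.det_diagonal]
  refine Finset.prod_ne_zero_iff.2 fun i _ => ?_
  split_ifs
  · exact hx
  · exact one_ne_zero

lemma det_t1 [NeZero n] (x : F) : (t1 n x).det = x := by
  rw [t1, Matrix.det_diagonal, Finset.prod_eq_single (0 : Fin n)]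
  · simp
  · intro i _ hi
    rw [if_neg fun h => hi (Fin.ext (by simpa using h))]
  · simp

lemma t1_mul_t1 (x y : F) : t1 n x * t1 n y = t1 n (x * y) := by
  rw [t1, t1, Matrix.diagonal_mul_diagonal, t1]
  congr 1
  ext i
  split_ifs <;> simp

lemma t1_mem_Kcong {ϖ u : F} {ℓ : ℤ} (hu : ‖u - 1‖ ≤ ‖ϖ‖ ^ ℓ) : t1 n u ∈ Kcong n ϖ ℓ := by
  intro i j
  have h0 : (0 : ℝ) ≤ ‖ϖ‖ ^ ℓ := zpow_nonneg (norm_nonneg _) _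
  rw [t1, Matrix.diagonal_apply, Matrix.one_apply]
  split_ifs
  · exact hu
  all_goals simpa using h0

lemma continuousAt_of_mul_right_invariant [IsUltrametricDist F] {ϖ : F} (hϖ0 : 0 < ‖ϖ‖) {m : ℤ}
    {χ : Matrix (Fin n) (Fin n) F → ℂ} (hχ : ∀ k ∈ Kcong n ϖ m, ∀ g, χ (g * k) = χ g)
    {g : Matrix (Fin n) (Fin n) F} (hg : g.det ≠ 0) : ContinuousAt χ g := by
  have hc : Continuous fun h : Matrix (Fin n) (Fin n) F => entryNorm (g⁻¹ * h - 1) :=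
    continuous_entryNorm.comp ((continuous_mulLeft_matrix g⁻¹).sub continuous_const)
  have hev : ∀ᶠ h in nhds g, entryNorm (g⁻¹ * h - 1) < ‖ϖ‖ ^ m := by
    refine hc.continuousAt.eventually_lt continuousAt_const ?_
    rw [Matrix.nonsing_inv_mul g hg.isUnit, sub_self, entryNorm_eq_zero_iff.2 rfl]
    exact zpow_pos hϖ0 _
  refine (tendsto_const_nhds (x := χ g)).congr' (hev.mono fun h hh => ?_)
  rw [← hχ _ (mem_Kcong_iff.2 hh.le) g, Matrix.mul_nonsing_inv_cancel_left g h hg.isUnit]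

lemma exists_zpow_neg_ge {ϖ : F} (hϖ0 : 0 < ‖ϖ‖) (hϖ1 : ‖ϖ‖ < 1) (m : ℤ) (R : ℝ) :
    ∃ L : ℤ, m ≤ L ∧ R ≤ ‖ϖ‖ ^ (-L) := by
  obtain ⟨N, hN⟩ := pow_unbounded_of_one_lt R ((one_lt_inv₀ hϖ0).2 hϖ1)
  refine ⟨max m N, le_max_left _ _, hN.le.trans ?_⟩
  rw [← zpow_natCast, _root_.inv_zpow, ← _root_.zpow_neg]
  exact zpow_le_zpow_right_of_le_one₀ hϖ0 hϖ1.le (neg_le_neg (le_max_right _ _))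

variable [MeasurableSpace (Matrix (Fin n) (Fin n) F)] [BorelSpace (Matrix (Fin n) (Fin n) F)]
  [ProperSpace F] [IsUltrametricDist F]

lemma integrableOn_char_trace_mul {ϖ : F} (hϖ0 : 0 < ‖ϖ‖) {ψ : F → ℂ} (hψc : Continuous ψ) {m : ℤ}
    {χ : Matrix (Fin n) (Fin n) F → ℂ} (hχ : ∀ k ∈ Kcong n ϖ m, ∀ g, χ (g * k) = χ g)
    (ν : Measure (Matrix (Fin n) (Fin n) F)) [IsFiniteMeasureOnCompacts ν] {x : F} (hx : x ≠ 0)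
    (hνx : ν {g | g.det ≠ x} = 0) (r : ℝ) :
    IntegrableOn (fun g => ψ g.trace * χ g) {g | entryNorm g ≤ r} ν := by
  have hcl : IsClosed {g : Matrix (Fin n) (Fin n) F | g.det = x} :=
    isClosed_eq continuous_id.matrix_det continuous_const
  have hK := (isCompact_entryNorm_le (n := n) (F := F) r).inter_right hcl
  have hcont : ContinuousOn (fun g => ψ g.trace * χ g)
      ({g : Matrix (Fin n) (Fin n) F | entryNorm g ≤ r} ∩ {g | g.det = x}) := fun g hg =>
    ((hψc.comp continuous_id.matrix_trace).continuousAt.mul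
      (continuousAt_of_mul_right_invariant hϖ0 hχ (hg.2.symm ▸ hx))).continuousWithinAt
  have := secondCountableTopology_matrix (n := n) (F := F)
  refine (hcont.integrableOn_compact hK).congr_set_ae ?_
  filter_upwards [show ∀ᵐ g ∂ν, g.det = x from hνx] with g hg
  exact propext ⟨fun h => ⟨h, hg⟩, fun h => h.1⟩

variable {ϖ : F} (hϖ0 : 0 < ‖ϖ‖) (hϖ1 : ‖ϖ‖ < 1)
  (hdisc : ∀ x : F, x ≠ 0 → ∃ k : ℤ, ‖x‖ = ‖ϖ‖ ^ k)
  {ψ : F → ℂ} (hψadd : ∀ x y : F, ψ (x + y) = ψ x * ψ y)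
  (hψnontriv : ∃ x : F, ‖x‖ ≤ ‖ϖ‖⁻¹ ∧ ψ x ≠ 1)
  {μ₁ : Measure (Matrix (Fin n) (Fin n) F)} (hμ₁supp : μ₁ {h | h.det ≠ 1} = 0)

include hϖ0 hϖ1 hdisc hψadd hψnontriv hμ₁supp in
lemma integral_convGJ_cFun (μp : Measure (Matrix (Fin n) (Fin n) F)) [μp.IsAddHaarMeasure]
    (hψtriv : ∀ x : F, ‖x‖ ≤ 1 → ψ x = 1) (φ : Matrix (Fin n) (Fin n) F → ℂ) {x : F} (hx : x ≠ 0)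
    {ℓ : ℤ} (hℓ : 1 ≤ ℓ) :
    ∫ h, convGJ n μp ψ (cFun n μp ϖ ℓ) (t1 n x * h) * φ (t1 n x * h) ∂μ₁ =
      ∫ h, {g | entryNorm g ≤ ‖ϖ‖ ^ (-ℓ)}.indicator
        (fun g => ψ g.trace * (convFactor μp g * φ g)) (t1 n x * h) ∂μ₁ := by
  refine integral_congr_ae ?_
  filter_upwards [show ∀ᵐ h ∂μ₁, h.det = 1 from hμ₁supp] with h hh
  have hdet : (t1 n x * h).det ≠ 0 := by
    rw [Matrix.det_mul, hh, mul_one]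
    exact det_t1_ne_zero n hx
  rw [convGJ_cFun μp hϖ0 hϖ1 hdisc hψadd hψtriv hψnontriv hℓ hdet]
  simp only [Set.indicator_apply, ite_mul, zero_mul, mul_assoc]

include hϖ0 hϖ1 hdisc hψadd hψnontriv hμ₁supp in
lemma integral_indicator_t1_mul_eq [MeasurableSpace F] [BorelSpace F] (hψc : Continuous ψ)
    (hμ₁inv : ∀ s : Matrix (Fin n) (Fin n) F, s.det = 1 → μ₁.map (fun h => s * h) = μ₁)
    (hμ₁fin : ∀ K : Set (Matrix (Fin n) (Fin n) F), IsCompact K → μ₁ K < ⊤)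
    {n₀ : ℤ} (hn₀ : 1 ≤ n₀) {χ : Matrix (Fin n) (Fin n) F → ℂ}
    (hχl : ∀ k ∈ Kcong n ϖ n₀, ∀ g, χ (k * g) = χ g)
    (hχr : ∀ k ∈ Kcong n ϖ n₀, ∀ g, χ (g * k) = χ g)
    {x : F} (hx : x ≠ 0) {L ℓ : ℤ} (hL : n₀ ≤ L) (hxL : ‖x‖ ≤ ‖ϖ‖ ^ (-L)) (hℓ : L ≤ ℓ) :
    ∫ h, {g | entryNorm g ≤ ‖ϖ‖ ^ (-ℓ)}.indicator (fun g => ψ g.trace * χ g) (t1 n x * h) ∂μ₁ =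
      ∫ h, {g | entryNorm g ≤ ‖ϖ‖ ^ (-L)}.indicator
        (fun g => ψ g.trace * χ g) (t1 n x * h) ∂μ₁ := by
  rcases Nat.eq_zero_or_pos n with rfl | hn
  · have hu : ∀ m : ℤ, ∀ h : Matrix (Fin 0) (Fin 0) F, h ∈ {g | entryNorm g ≤ ‖ϖ‖ ^ m} :=
      fun m h => (entryNorm_le_iff (zpow_nonneg hϖ0.le _)).2 fun i => i.elim0
    simp only [Set.indicator_of_mem (hu _ _)]
  have : NeZero n := ⟨hn.ne'⟩
  have hdet : (t1 n x).det ≠ 0 := det_t1_ne_zero n hx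
  have hemb := measurableEmbedding_matrix_mulLeft hdet
  have hmeas : ∀ A : Matrix (Fin n) (Fin n) F, Measurable fun h => A * h := fun A =>
    (continuous_mulLeft_matrix A).measurable
  set ν := μ₁.map (fun h => t1 n x * h) with hν
  have hint : ∀ m : ℤ,
      ∫ h, {g | entryNorm g ≤ ‖ϖ‖ ^ m}.indicator (fun g => ψ g.trace * χ g) (t1 n x * h) ∂μ₁ =
        ∫ g in {g | entryNorm g ≤ ‖ϖ‖ ^ m}, ψ g.trace * χ g ∂ν := fun m => by
    rw [← integral_indicator (measurableSet_entryNorm_le _), hν, hemb.integral_map]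
  have hνinv : ∀ s : Matrix (Fin n) (Fin n) F, s.det = 1 → ν.map (fun h => s * h) = ν := by
    intro s hs
    have hs' : ((t1 n x)⁻¹ * s * t1 n x).det = 1 := by
      rw [Matrix.det_mul, Matrix.det_mul, hs, mul_one, ← Matrix.det_mul,
        Matrix.nonsing_inv_mul _ hdet.isUnit, Matrix.det_one]
    conv_rhs => rw [hν, ← hμ₁inv _ hs']
    rw [hν, Measure.map_map (hmeas _) (hmeas _), Measure.map_map (hmeas _) (hmeas _)]
    congr 1
    ext1 h
    simp only [Function.comp_apply, mul_assoc]
    rw [Matrix.mul_nonsing_inv_cancel_left _ _ hdet.isUnit]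
  have hνfin : IsFiniteMeasureOnCompacts ν := ⟨fun K hK => by
    rw [hν, hemb.map_apply]
    have : (fun h => t1 n x * h) ⁻¹' K = (fun h => (t1 n x)⁻¹ * h) '' K := by
      ext h
      refine ⟨fun hh => ⟨_, hh, Matrix.nonsing_inv_mul_cancel_left _ _ hdet.isUnit⟩, ?_⟩
      rintro ⟨g, hg, rfl⟩
      rwa [Set.mem_preimage, Matrix.mul_nonsing_inv_cancel_left _ _ hdet.isUnit]
    rw [this]
    exact hμ₁fin _ (hK.image (continuous_mulLeft_matrix _))⟩
  have hνx : ν {g | g.det ≠ x} = 0 := by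
    rw [hν, hemb.map_apply, Set.preimage_ofPred_eq]
    simpa only [Matrix.det_mul, det_t1, ne_eq, mul_eq_left₀ hx] using hμ₁supp
  rw [hint, hint]
  exact setIntegral_char_trace_ball_eq hϖ0 hϖ1 hdisc hψc hψadd hψnontriv hνinv hn₀ hχl hνx hL hxL
    hℓ (integrableOn_char_trace_mul hϖ0 hψc hχr ν hx hνx _)

omit [MeasurableSpace (Matrix (Fin n) (Fin n) F)] [BorelSpace (Matrix (Fin n) (Fin n) F)]
  [ProperSpace F] in
include hϖ0 hϖ1 hψadd in
lemma indicator_char_trace_mul_left (hψtriv : ∀ x : F, ‖x‖ ≤ 1 → ψ x = 1)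
    {n₀ : ℤ} (hn₀ : 1 ≤ n₀) {χ : Matrix (Fin n) (Fin n) F → ℂ}
    (hχ : ∀ k ∈ Kcong n ϖ n₀, ∀ g, χ (k * g) = χ g) {L : ℤ} (hL : n₀ ≤ L)
    {k : Matrix (Fin n) (Fin n) F} (hk : k ∈ Kcong n ϖ L) (g : Matrix (Fin n) (Fin n) F) :
    {g | entryNorm g ≤ ‖ϖ‖ ^ (-L)}.indicator (fun g => ψ g.trace * χ g) (k * g) =
      {g | entryNorm g ≤ ‖ϖ‖ ^ (-L)}.indicator (fun g => ψ g.trace * χ g) g := by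
  have hkL := mem_Kcong_iff.1 hk
  have hkn₀ : k ∈ Kcong n ϖ n₀ :=
    mem_Kcong_iff.2 (hkL.trans (zpow_le_zpow_right_of_le_one₀ hϖ0 hϖ1.le hL))
  have hk1 := entryNorm_sub_one_lt_one hϖ0 hϖ1 hn₀ hkn₀
  simp only [Set.indicator_apply, Set.mem_ofPred_eq, entryNorm_mul_left hk1, hχ k hkn₀]
  split_ifs with hg
  · have htr : (k * g).trace = g.trace + ((k - 1) * g).trace := by
      rw [← Matrix.trace_add, sub_mul, one_mul, add_sub_cancel]
    rw [htr, hψadd, hψtriv ((k - 1) * g).trace ?_, mul_one]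
    calc ‖((k - 1) * g).trace‖ ≤ entryNorm (k - 1) * entryNorm g :=
          (norm_trace_le_entryNorm _).trans (entryNorm_mul_le _ _)
      _ ≤ ‖ϖ‖ ^ L * ‖ϖ‖ ^ (-L) :=
          mul_le_mul hkL hg (entryNorm_nonneg _) (zpow_nonneg hϖ0.le _)
      _ = 1 := by rw [← zpow_add₀ hϖ0.ne', add_neg_cancel, zpow_zero]
  · rfl

end FiberIntegral

/-- Let `φ : GL_n(F) → ℂ` be bi-invariant under a principal congruence
subgroup `K_{n₀}`.  Then for every `x ∈ Fˣ` the limit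
`k(x) = lim_{ℓ→∞} ∫_{det g = x} (Φ_GJ * c_ℓ^∨)(g)·φ(g) d_xg` exists — the sequence of fiber
integrals is eventually constant in `ℓ`, uniformly for `x` in any open compact subset of
`Fˣ` — and the resulting function `k : Fˣ → ℂ` is smooth, i.e. locally constant on `Fˣ`. -/
theorem statement6
    {F : Type*} [NontriviallyNormedField F] [CompleteSpace F] [ProperSpace F]
    [CharZero F] [MeasurableSpace F] [BorelSpace F]
    (hna : ∀ x y : F, ‖x + y‖ ≤ max ‖x‖ ‖y‖)
    (ϖ : F) (hϖ0 : 0 < ‖ϖ‖) (hϖ1 : ‖ϖ‖ < 1)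
    (hdisc : ∀ x : F, x ≠ 0 → ∃ k : ℤ, ‖x‖ = ‖ϖ‖ ^ k)
    (ψ : F → ℂ) (hψc : Continuous ψ)
    (hψadd : ∀ x y : F, ψ (x + y) = ψ x * ψ y)
    (hψtriv : ∀ x : F, ‖x‖ ≤ 1 → ψ x = 1)
    (hψnontriv : ∃ x : F, ‖x‖ ≤ ‖ϖ‖⁻¹ ∧ ψ x ≠ 1)
    (n : ℕ)
    [MeasurableSpace (Matrix (Fin n) (Fin n) F)]
    [BorelSpace (Matrix (Fin n) (Fin n) F)]
    -- `μp` is the additive Haar measure `d⁺X` on `M_n(F)`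
    (μp : Measure (Matrix (Fin n) (Fin n) F)) [μp.IsAddHaarMeasure]
    -- `μ₁` is a Haar measure of `SL_n(F)`, viewed as a measure on the matrix space
    (μ₁ : Measure (Matrix (Fin n) (Fin n) F))
    (hμ₁supp : μ₁ {h | h.det ≠ 1} = 0)
    (hμ₁inv : ∀ s : Matrix (Fin n) (Fin n) F, s.det = 1 →
      Measure.map (fun h => s * h) μ₁ = μ₁)
    (hμ₁fin : ∀ K : Set (Matrix (Fin n) (Fin n) F), IsCompact K → μ₁ K < ⊤)
    -- `φ` is bi-invariant under the principal congruence subgroup `K_{n₀}`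
    (φ : Matrix (Fin n) (Fin n) F → ℂ)
    (n₀ : ℤ) (hn₀ : 1 ≤ n₀)
    (hφinv : ∀ g : Matrix (Fin n) (Fin n) F,
      ∀ k₁ ∈ Kcong n ϖ n₀, ∀ k₂ ∈ Kcong n ϖ n₀, φ (k₁ * g * k₂) = φ g) :
    ∃ k : F → ℂ,
      -- the fiber integrals are eventually constant in `ℓ`, uniformly for `x` in any open
      -- compact subset of `Fˣ`, with common eventual value `k x`
      (∀ 𝔫 : Set F, IsOpen 𝔫 → IsCompact 𝔫 → (∀ x ∈ 𝔫, x ≠ 0) →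
        ∃ L : ℤ, ∀ ℓ : ℤ, L ≤ ℓ → ∀ x ∈ 𝔫,
          (∫ h, convGJ n μp ψ (cFun n μp ϖ ℓ) (t1 n x * h) * φ (t1 n x * h) ∂μ₁) = k x) ∧
      -- in particular, for every `x ∈ Fˣ` the limit as `ℓ → ∞` exists and equals `k x`
      (∀ x : F, x ≠ 0 →
        Filter.Tendsto
          (fun ℓ : ℤ =>
            ∫ h, convGJ n μp ψ (cFun n μp ϖ ℓ) (t1 n x * h) * φ (t1 n x * h) ∂μ₁)
          Filter.atTop (nhds (k x))) ∧
      -- and `k` is smooth, i.e. locally constant, on `Fˣ`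
      (∀ x : F, x ≠ 0 → ∀ᶠ y in nhds x, k y = k x) := by
  have : IsUltrametricDist F :=
    IsUltrametricDist.isUltrametricDist_of_forall_norm_add_le_max_norm hna
  set χ : Matrix (Fin n) (Fin n) F → ℂ := fun g => convFactor μp g * φ g with hχ
  have hone : (1 : Matrix (Fin n) (Fin n) F) ∈ Kcong n ϖ n₀ := fun i j => by
    rw [sub_self, norm_zero]
    exact zpow_nonneg hϖ0.le _
  have hχl : ∀ k ∈ Kcong n ϖ n₀, ∀ g, χ (k * g) = χ g := fun k hk g => by
    have hφ := hφinv g k hk 1 hone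
    rw [mul_one] at hφ
    simp only [hχ, hφ, convFactor_mul_left μp (entryNorm_sub_one_lt_one hϖ0 hϖ1 hn₀ hk)]
  have hχr : ∀ k ∈ Kcong n ϖ n₀, ∀ g, χ (g * k) = χ g := fun k hk g => by
    have hφ := hφinv g 1 hone k hk
    rw [one_mul] at hφ
    simp only [hχ, hφ, convFactor_mul_right μp (entryNorm_sub_one_lt_one hϖ0 hϖ1 hn₀ hk)]
  set I : ℤ → F → ℂ := fun ℓ x =>
    ∫ h, convGJ n μp ψ (cFun n μp ϖ ℓ) (t1 n x * h) * φ (t1 n x * h) ∂μ₁ with hI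
  have hIeq : ∀ {x : F}, x ≠ 0 → ∀ {ℓ : ℤ}, 1 ≤ ℓ → I ℓ x =
      ∫ h, {g | entryNorm g ≤ ‖ϖ‖ ^ (-ℓ)}.indicator
        (fun g => ψ g.trace * χ g) (t1 n x * h) ∂μ₁ := fun hx _ hℓ =>
    integral_convGJ_cFun hϖ0 hϖ1 hdisc hψadd hψnontriv hμ₁supp μp hψtriv φ hx hℓ
  choose L hLn₀ hLR using exists_zpow_neg_ge hϖ0 hϖ1 n₀
  have hstab : ∀ R x, x ≠ 0 → ‖x‖ ≤ R → ∀ ℓ, L R ≤ ℓ → I ℓ x = I (L R) x := by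
    intro R x hx hxR ℓ hℓ
    rw [hIeq hx (hn₀.trans ((hLn₀ R).trans hℓ)), hIeq hx (hn₀.trans (hLn₀ R))]
    exact integral_indicator_t1_mul_eq hϖ0 hϖ1 hdisc hψadd hψnontriv hμ₁supp hψc hμ₁inv hμ₁fin hn₀
      hχl hχr hx (hLn₀ R) (hxR.trans (hLR R)) hℓ
  have hk : ∀ R x, x ≠ 0 → ‖x‖ ≤ R → ∀ ℓ, L R ≤ ℓ → I ℓ x = I (L ‖x‖) x := by
    intro R x hx hxR ℓ hℓ
    rw [hstab R x hx hxR ℓ hℓ, ← hstab R x hx hxR _ (le_max_left _ (L ‖x‖)),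
      hstab ‖x‖ x hx le_rfl _ (le_max_right _ _)]
  refine ⟨fun x => I (L ‖x‖) x, fun 𝔫 _ hc h0 => ?_, fun x hx => ?_, fun x hx => ?_⟩
  · obtain ⟨R, hR⟩ := hc.isBounded.exists_norm_le
    exact ⟨L R, fun ℓ hℓ x hx => hk R x (h0 x hx) (hR x hx) ℓ hℓ⟩
  · refine tendsto_const_nhds.congr' ?_
    filter_upwards [Filter.eventually_ge_atTop (L ‖x‖)] with ℓ hℓ
    exact (hk ‖x‖ x hx le_rfl ℓ hℓ).symm
  · set R := ‖x‖ + 1 with hR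
    have hxR : ‖x‖ < R := lt_add_one _
    have hnear : ∀ᶠ y in nhds x, ‖y * x⁻¹ - 1‖ < ‖ϖ‖ ^ L R := by
      refine ContinuousAt.eventually_lt (by fun_prop) continuousAt_const ?_
      rw [mul_inv_cancel₀ hx, sub_self, norm_zero]
      exact zpow_pos hϖ0 _
    filter_upwards [hnear, continuous_norm.continuousAt.eventually_lt continuousAt_const hxR,
      eventually_ne_nhds hx] with y hy hyR hy0
    rw [← hk R y hy0 hyR.le _ le_rfl, ← hk R x hx hxR.le _ le_rfl,
      hIeq hy0 (hn₀.trans (hLn₀ R)), hIeq hx (hn₀.trans (hLn₀ R))]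
    congr 1
    ext1 h
    rw [← inv_mul_cancel_right₀ hx y, ← t1_mul_t1, mul_assoc]
    exact indicator_char_trace_mul_left hϖ0 hϖ1 hψadd hψtriv hn₀ hχl (hLn₀ R)
      (t1_mem_Kcong hy.le) _
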